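/- Let ζ > 0 and ε > 0, set a = ζ/ε, and for each real d let μ_d be the measure on ℝ with density x ↦ (1/(2a)) · exp(−|x − d|/a) with respect to Lebesgue measure. Then for all real numbers d, d' with |d − d'| ≤ ζ and every measurable set A ⊆ ℝ, μ_d(A) ≤ exp(ε) · μ_{d'}(A). -/

import Mathlib

open MeasureTheory

/-- Event-level `ε`-local differential privacy of the Laplacian mechanism: with
scale `a = ζ/ε`, for `ζ`-adjacent inputs `d, d'` the output distribution `μ_d`
(the Laplace density centered at `d` w.r.t. Lebesgue measure) satisfies
`μ_d(A) ≤ e^ε · μ_{d'}(A)` for every measurable `A`. -/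
theorem laplace_mechanism_ldp (ζ ε : ℝ) (hζ : 0 < ζ) (hε : 0 < ε)
    (a : ℝ) (ha : a = ζ / ε)
    (μ : ℝ → Measure ℝ)
    (hμ : ∀ d, μ d = volume.withDensity
      (fun x => ENNReal.ofReal ((1 / (2 * a)) * Real.exp (-|x - d| / a))))
    (d d' : ℝ) (hadj : |d - d'| ≤ ζ)
    (A : Set ℝ) (hA : MeasurableSet A) :
    μ d A ≤ ENNReal.ofReal (Real.exp ε) * μ d' A := by
  have ha0 : 0 < a := ha ▸ div_pos hζ hε
  have hexp : ∀ x : ℝ, -|x - d| / a ≤ ε + -|x - d'| / a := fun x => by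
    have hεa : ε * a = ζ := by rw [ha]; field_simp
    have htri : |x - d'| ≤ |x - d| + |d - d'| := abs_sub_le x d d'
    have heq : ε + -|x - d'| / a - -|x - d| / a = (|x - d| + ζ - |x - d'|) / a := by
      rw [← hεa]; field_simp; ring
    rw [← sub_nonneg, heq]
    exact div_nonneg (by linarith) ha0.le
  rw [hμ d, hμ d', withDensity_apply _ hA, withDensity_apply _ hA,
    ← lintegral_const_mul' _ _ ENNReal.ofReal_ne_top]
  refine lintegral_mono fun x => ?_
  rw [← ENNReal.ofReal_mul (Real.exp_pos ε).le]
  refine ENNReal.ofReal_le_ofReal ?_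
  rw [mul_left_comm, ← Real.exp_add]
  exact mul_le_mul_of_nonneg_left (Real.exp_le_exp.mpr (hexp x)) (by positivity)
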